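/- arXiv:2410.23147 — 2 statements merged into one kernel-verified Lean document; each statement's English description precedes it below -/
import Mathlib

section
/- Let n be a positive natural number, let x : Fin n → ℝ be a vector of observed values, and let M ⊆ Fin n be the set of indices at which the value is missing. For a constant c ∈ ℝ, let X_c : Fin n → ℝ denote the imputed vector defined by X_c(i) = c if i ∈ M and X_c(i) = x(i) otherwise, and let X⁻ : Fin n → ℝ denote the missing-value indicator defined by X⁻(i) = 1 if i ∈ M and X⁻(i) = 0 otherwise. Then for any constants c₁, c₂ ∈ ℝ, the linear span of {X_{c₁}, X⁻} in ℝⁿ equals the linear span of {X_{c₂}, X⁻}; that is, the column space of the imputed predictor together with its missing-value indicator does not depend on the choice of imputation constant. -/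
/-- Changing the imputation constant does not enlarge the span of the imputed vector and the
missing-value indicator. -/
theorem span_imputation_le {ι : Type*} (x : ι → ℝ) (M : Set ι) [DecidablePred (· ∈ M)]
    (c d : ℝ) :
    Submodule.span ℝ
        ({(fun i => if i ∈ M then c else x i),
          (fun i => if i ∈ M then (1 : ℝ) else 0)} : Set (ι → ℝ)) ≤
    Submodule.span ℝ
        ({(fun i => if i ∈ M then d else x i),
          (fun i => if i ∈ M then (1 : ℝ) else 0)} : Set (ι → ℝ)) := by
  rw [Submodule.span_le, Set.pair_subset_iff]
  refine ⟨Submodule.mem_span_pair.2 ⟨1, c - d, ?_⟩, Submodule.subset_span (by simp)⟩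
  ext i
  by_cases h : i ∈ M <;> simp [h]

/-- The span of the constant-imputed predictor together with its
missing-value indicator does not depend on the imputation constant:
`span {X_{c₁}, X⁻} = span {X_{c₂}, X⁻}`. -/
theorem imputation_span_independent (n : ℕ) (hn : 0 < n)
    (x : Fin n → ℝ) (M : Set (Fin n)) [DecidablePred (· ∈ M)]
    (c₁ c₂ : ℝ) :
    Submodule.span ℝ
        ({(fun i => if i ∈ M then c₁ else x i),
          (fun i => if i ∈ M then (1 : ℝ) else 0)} : Set (Fin n → ℝ)) =
    Submodule.span ℝ
        ({(fun i => if i ∈ M then c₂ else x i),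
          (fun i => if i ∈ M then (1 : ℝ) else 0)} : Set (Fin n → ℝ)) := by
  exact le_antisymm (span_imputation_le x M c₁ c₂) (span_imputation_le x M c₂ c₁)
end

section
/- Let n and K be positive natural numbers. For each k ∈ Fin K let x_k : Fin n → ℝ be a vector of observed values and M_k ⊆ Fin n the set of missing indices for predictor k; for a constant c ∈ ℝ let X_{k,c} : Fin n → ℝ be defined by X_{k,c}(i) = c if i ∈ M_k and X_{k,c}(i) = x_k(i) otherwise, and let X⁻_k be the indicator of M_k. Then for any two choices of imputation constants c = (c₁,…,c_K) and c' = (c'₁,…,c'_K) in ℝ^K, the linear span in ℝⁿ of the 2K vectors {X_{1,c₁}, X⁻_1, …, X_{K,c_K}, X⁻_K} equals the linear span of {X_{1,c'₁}, X⁻_1, …, X_{K,c'_K}, X⁻_K}. -/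
/-- The span of an imputed vector and the missing-value indicator for one
imputation constant is contained in the span for any other. -/
theorem span_imputed_indicator_le {R ι : Type*} [Ring R] (x : ι → R) (M : Set ι)
    [DecidablePred (· ∈ M)] (c c' : R) :
    Submodule.span R ({(fun i => if i ∈ M then c else x i),
        (fun i => if i ∈ M then (1 : R) else 0)} : Set (ι → R)) ≤
      Submodule.span R ({(fun i => if i ∈ M then c' else x i),
        (fun i => if i ∈ M then (1 : R) else 0)} : Set (ι → R)) := by
  rw [Submodule.span_le, Set.pair_subset_iff]
  refine ⟨Submodule.mem_span_pair.2 ⟨1, c - c', ?_⟩, Submodule.subset_span (by simp)⟩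
  ext i
  by_cases h : i ∈ M <;> simp [h]

/-- For `K` predictors `x k` with missing index sets `M k`, the
span of the `2K` vectors consisting of each constant-imputed predictor
(imputation constant `c k`) together with its missing-value indicator does not
depend on the choice of imputation constants `c : Fin K → ℝ`. -/
theorem imputation_span_independent_multi (n K : ℕ) (hn : 0 < n) (hK : 0 < K)
    (x : Fin K → Fin n → ℝ) (M : Fin K → Set (Fin n))
    [∀ k, DecidablePred (· ∈ M k)]
    (c c' : Fin K → ℝ) :
    Submodule.span ℝ
        (⋃ k : Fin K,
          ({(fun i => if i ∈ M k then c k else x k i),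
            (fun i => if i ∈ M k then (1 : ℝ) else 0)} : Set (Fin n → ℝ))) =
    Submodule.span ℝ
        (⋃ k : Fin K,
          ({(fun i => if i ∈ M k then c' k else x k i),
            (fun i => if i ∈ M k then (1 : ℝ) else 0)} : Set (Fin n → ℝ))) := by
  simp only [Submodule.span_iUnion]
  exact iSup_congr fun k => le_antisymm (span_imputed_indicator_le (x k) (M k) _ _)
    (span_imputed_indicator_le (x k) (M k) _ _)
end
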